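/- arXiv:1607.02276 — 6 statements merged into one kernel-verified Lean document; each statement's English description precedes it below -/
import Mathlib

section
/- Let E be a real Banach space, U, V ⊆ E open sets and φ : U → V a C³ diffeomorphism. Let N : ℝ × U × E → L(ℝ × E, E) and N' : ℝ × V × E → L(ℝ × E, E) satisfy the connection compatibility condition dφ(x)[N(t,x,y)(s,a)] = N'(t, φ(x), dφ(x)y)(s, dφ(x)a) + d²φ(x)(a,y) for all (t,x,y) ∈ ℝ × U × E and (s,a) ∈ ℝ × E. Then for every t ∈ ℝ and every C² curve γ : (−ε, ε) → U, writing x = γ(0) and y = γ'(0), one has (φ∘γ)''(0) + N'(t, φ(x), dφ(x)y)(1, dφ(x)y) = dφ(x)[γ''(0) + N(t, x, y)(1, y)]. -/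
open Set

/-- The second derivative of `φ ∘ γ` at `t₀`, by the chain and product rules. -/
theorem deriv_deriv_comp_of_eventually
    {E F : Type*} [NormedAddCommGroup E] [NormedSpace ℝ E]
    [NormedAddCommGroup F] [NormedSpace ℝ F]
    {φ : E → F} {dφ : E → E →L[ℝ] F} {d2φ : E →L[ℝ] E →L[ℝ] F} {γ : ℝ → E} {t₀ : ℝ}
    (hφ : ∀ᶠ t in nhds t₀, HasFDerivAt φ (dφ (γ t)) (γ t))
    (hdφ : HasFDerivAt dφ d2φ (γ t₀))
    (hγ : ∀ᶠ t in nhds t₀, DifferentiableAt ℝ γ t)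
    (hγ' : DifferentiableAt ℝ (deriv γ) t₀) :
    deriv (deriv (φ ∘ γ)) t₀
      = d2φ (deriv γ t₀) (deriv γ t₀) + dφ (γ t₀) (deriv (deriv γ) t₀) := by
  have hderiv : deriv (φ ∘ γ) =ᶠ[nhds t₀] fun t => dφ (γ t) (deriv γ t) := by
    filter_upwards [hφ, hγ] with t h₁ h₂
    exact (h₁.comp_hasDerivAt t h₂.hasDerivAt).deriv
  rw [hderiv.deriv_eq]
  exact ((hdφ.comp_hasDerivAt t₀ hγ.self_of_nhds.hasDerivAt).clm_apply hγ'.hasDerivAt).deriv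

/-- If the nonlinear-connection coefficients `N`, `N'` satisfy the
compatibility condition, then along any C² curve the second order data built from the
connection transform tensorially. -/
theorem connection_transition_along_curve
    {E : Type*} [NormedAddCommGroup E] [NormedSpace ℝ E] [CompleteSpace E]
    (U V : Set E) (hU : IsOpen U) (hV : IsOpen V)
    (φ ψ : E → E) (hφ : ContDiffOn ℝ 3 φ U) (hψ : ContDiffOn ℝ 3 ψ V)
    (hφUV : MapsTo φ U V) (hψVU : MapsTo ψ V U)
    (hleft : ∀ x ∈ U, ψ (φ x) = x) (hright : ∀ y ∈ V, φ (ψ y) = y)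
    (dφ : E → E →L[ℝ] E) (hdφ : ∀ x ∈ U, HasFDerivAt φ (dφ x) x)
    (d2φ : E → E →L[ℝ] E →L[ℝ] E) (hd2φ : ∀ x ∈ U, HasFDerivAt dφ (d2φ x) x)
    (N N' : ℝ → E → E → (ℝ × E →L[ℝ] E))
    (hcomp : ∀ (t s : ℝ), ∀ x ∈ U, ∀ y a : E,
      dφ x (N t x y (s, a)) = N' t (φ x) (dφ x y) (s, dφ x a) + d2φ x a y) :
    ∀ (t ε : ℝ), 0 < ε → ∀ γ : ℝ → E,
      MapsTo γ (Ioo (-ε) ε) U → ContDiffOn ℝ 2 γ (Ioo (-ε) ε) →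
      -- (φ∘γ)''(0) + N'(t, φ(x), dφ(x)y)(1, dφ(x)y) = dφ(x)[γ''(0) + N(t,x,y)(1,y)]
      deriv (deriv (φ ∘ γ)) 0
          + N' t (φ (γ 0)) (dφ (γ 0) (deriv γ 0)) (1, dφ (γ 0) (deriv γ 0))
        = dφ (γ 0) (deriv (deriv γ) 0 + N t (γ 0) (deriv γ 0) (1, deriv γ 0)) := by
  intro t ε hε γ hγU hγ
  have h0 : (0 : ℝ) ∈ Ioo (-ε) ε := ⟨neg_lt_zero.mpr hε, hε⟩
  have hmem : ∀ᶠ r in nhds (0 : ℝ), r ∈ Ioo (-ε) ε := isOpen_Ioo.mem_nhds h0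
  have hγ' : DifferentiableAt ℝ (deriv γ) 0 :=
    ((hγ.deriv_of_isOpen (m := 1) isOpen_Ioo (by norm_num)).differentiableOn
      one_ne_zero).differentiableAt hmem
  have hγd : ∀ᶠ r in nhds (0 : ℝ), DifferentiableAt ℝ γ r :=
    hmem.mono fun r hr =>
      (hγ.differentiableOn two_ne_zero).differentiableAt (isOpen_Ioo.mem_nhds hr)
  rw [deriv_deriv_comp_of_eventually (hmem.mono fun r hr => hdφ _ (hγU hr))
    (hd2φ _ (hγU h0)) hγd hγ', map_add, hcomp t 1 _ (hγU h0)]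
  abel
end

section
/- Let L : ℝ × U × E → ℝ be a regular time dependent Lagrangian of class C². Then there exists exactly one pair of maps X₁, X₂ : ℝ × U × E → E such that for all v = (t,x,y) ∈ ℝ × U × E and all (s,z,w) ∈ ℝ × E × E one has Ω_L(v)((1, X₁(v), X₂(v)), (s,z,w)) = 0. Moreover X₁(t,x,y) = y (so the resulting vector field Z(v) = (1, y, X₂(v)) is a time dependent semispray), and X₂(v) is the unique element of E satisfying ∂₃²L(v)[z, X₂(v)] = ∂₂L(v)z − ∂₁∂₃L(v)[z] − ∂₂∂₃L(v)[z, y] for all z ∈ E. -/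
open Set

variable {E : Type*} [NormedAddCommGroup E] [NormedSpace ℝ E]

/-- `∂₁L(t,x,y)`, partial derivative of the Lagrangian in the time variable. -/
noncomputable def d1L (L : ℝ → E → E → ℝ) (t : ℝ) (x y : E) : ℝ :=
  deriv (fun t' => L t' x y) t

/-- `∂₂L(t,x,y)`, partial Fréchet derivative of the Lagrangian in the base variable. -/
noncomputable def d2L (L : ℝ → E → E → ℝ) (t : ℝ) (x y : E) : E →L[ℝ] ℝ :=
  fderiv ℝ (fun x' => L t x' y) x

/-- `∂₃L(t,x,y)`, partial Fréchet derivative of the Lagrangian in the fiber variable. -/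
noncomputable def d3L (L : ℝ → E → E → ℝ) (t : ℝ) (x y : E) : E →L[ℝ] ℝ :=
  fderiv ℝ (fun y' => L t x y') y

/-- `d13L L t x y z` is `∂₁∂₃L(t,x,y)[z]`, the time derivative of `∂₃L(·,x,y)z`. -/
noncomputable def d13L (L : ℝ → E → E → ℝ) (t : ℝ) (x y : E) : E →L[ℝ] ℝ :=
  deriv (fun t' => d3L L t' x y) t

/-- `d23L L t x y a z` is `∂₂∂₃L(t,x,y)[z,a]`, the derivative in base direction `a` of
`∂₃L(t,·,y)z`. -/
noncomputable def d23L (L : ℝ → E → E → ℝ) (t : ℝ) (x y : E) : E →L[ℝ] E →L[ℝ] ℝ :=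
  fderiv ℝ (fun x' => d3L L t x' y) x

/-- `d33L L t x y w z` is `∂₃²L(t,x,y)[z,w]`, the derivative in fiber direction `w` of
`∂₃L(t,x,·)z`. -/
noncomputable def d33L (L : ℝ → E → E → ℝ) (t : ℝ) (x y : E) : E →L[ℝ] E →L[ℝ] ℝ :=
  fderiv ℝ (fun y' => d3L L t x y') y

/-- A time dependent Lagrangian `L` is regular on `U` if it is C² and at every point of
`ℝ × U × E` the map `X ↦ ∂₃²L(v)[·, X]` is a continuous linear isomorphism `E → E*`. -/
def RegularLagrangian (L : ℝ → E → E → ℝ) (U : Set E) : Prop :=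
  ContDiffOn ℝ 2 (fun p : ℝ × E × E => L p.1 p.2.1 p.2.2) (univ ×ˢ U ×ˢ univ) ∧
  ∀ t : ℝ, ∀ x ∈ U, ∀ y : E,
    ∃ e : E ≃L[ℝ] (E →L[ℝ] ℝ), ∀ X : E, e X = d33L L t x y X

/-- The fundamental 2-form `ω_L` of a time dependent Lagrangian (local expression). -/
noncomputable def omegaL (L : ℝ → E → E → ℝ) (t : ℝ) (x y : E) (u₁ u₂ : ℝ × E × E) : ℝ :=
  d13L L t x y u₁.2.1 * u₂.1 - d13L L t x y u₂.2.1 * u₁.1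
    + d23L L t x y u₂.2.1 u₁.2.1 - d23L L t x y u₁.2.1 u₂.2.1
    + d33L L t x y u₂.2.2 u₁.2.1 - d33L L t x y u₁.2.2 u₂.2.1

/-- The energy `E_L(t,x,y) = ∂₃L(t,x,y)y − L(t,x,y)`. -/
noncomputable def energyL (L : ℝ → E → E → ℝ) (t : ℝ) (x y : E) : ℝ :=
  d3L L t x y y - L t x y

/-- The Fréchet differential of the energy. -/
noncomputable def dEnergyL (L : ℝ → E → E → ℝ) (t : ℝ) (x y : E) : ℝ × E × E →L[ℝ] ℝ :=
  fderiv ℝ (fun p : ℝ × E × E => energyL L p.1 p.2.1 p.2.2) (t, x, y)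

/-- `Ω_L = ω_L + dE_L ∧ dt` (local expression). -/
noncomputable def bigOmegaL (L : ℝ → E → E → ℝ) (t : ℝ) (x y : E) (u₁ u₂ : ℝ × E × E) : ℝ :=
  omegaL L t x y u₁ u₂ + dEnergyL L t x y u₁ * u₂.1 - dEnergyL L t x y u₂ * u₁.1

theorem hasFDerivAt_base {F : Type*} [NormedAddCommGroup F] [NormedSpace ℝ F]
    {f : ℝ × E × E → F} {f' : ℝ × E × E →L[ℝ] F} {t : ℝ} {x y : E}
    (hf : HasFDerivAt f f' (t, x, y)) :
    HasFDerivAt (fun x' => f (t, x', y))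
      (f'.comp ((0 : E →L[ℝ] ℝ).prod ((ContinuousLinearMap.id ℝ E).prod 0))) x :=
  HasFDerivAt.comp x hf ((hasFDerivAt_const t x).prodMk
    ((hasFDerivAt_id x).prodMk (hasFDerivAt_const y x)))

theorem hasFDerivAt_fiber {F : Type*} [NormedAddCommGroup F] [NormedSpace ℝ F]
    {f : ℝ × E × E → F} {f' : ℝ × E × E →L[ℝ] F} {t : ℝ} {x y : E}
    (hf : HasFDerivAt f f' (t, x, y)) :
    HasFDerivAt (fun y' => f (t, x, y'))
      (f'.comp ((0 : E →L[ℝ] ℝ).prod ((0 : E →L[ℝ] E).prod (ContinuousLinearMap.id ℝ E)))) y :=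
  HasFDerivAt.comp y hf ((hasFDerivAt_const t y).prodMk
    ((hasFDerivAt_const x y).prodMk (hasFDerivAt_id y)))

/-- The fiber derivative of a C² Lagrangian is differentiable in all variables jointly. -/
theorem differentiableAt_d3L {L : ℝ → E → E → ℝ} {t : ℝ} {x y : E}
    (hL : ContDiffAt ℝ 2 (fun p : ℝ × E × E => L p.1 p.2.1 p.2.2) (t, x, y)) :
    DifferentiableAt ℝ (fun p : ℝ × E × E => d3L L p.1 p.2.1 p.2.2) (t, x, y) := by
  have hG : DifferentiableAt ℝ
      (fderiv ℝ (fun p : ℝ × E × E => L p.1 p.2.1 p.2.2)) (t, x, y) :=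
    (hL.fderiv_right (m := 1) (by norm_num)).differentiableAt (by norm_num)
  refine (hG.clm_comp (differentiableAt_const
    ((0 : E →L[ℝ] ℝ).prod ((0 : E →L[ℝ] E).prod (ContinuousLinearMap.id ℝ E)))))
    |>.congr_of_eventuallyEq ?_
  filter_upwards [hL.eventually (by simp)] with p hp
  exact (hasFDerivAt_fiber (hp.differentiableAt (by norm_num)).hasFDerivAt).fderiv

/-- The differential of the energy in the base and fiber directions. -/
theorem dEnergyL_zero_left {L : ℝ → E → E → ℝ} {t : ℝ} {x y : E}
    (hL : ContDiffAt ℝ 2 (fun p : ℝ × E × E => L p.1 p.2.1 p.2.2) (t, x, y)) (z w : E) :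
    dEnergyL L t x y (0, z, w) = d23L L t x y z y - d2L L t x y z + d33L L t x y w y := by
  have hF := (hL.differentiableAt (by norm_num)).hasFDerivAt
  have hD := (differentiableAt_d3L hL).hasFDerivAt
  have h2 : d2L L t x y = _ := (hasFDerivAt_base hF).fderiv
  have h3 : d3L L t x y = _ := (hasFDerivAt_fiber hF).fderiv
  have h23 : d23L L t x y = _ := (hasFDerivAt_base hD).fderiv
  have h33 : d33L L t x y = _ := (hasFDerivAt_fiber hD).fderiv
  have hE : dEnergyL L t x y = _ := ((hD.clm_apply
    (hasFDerivAt_snd.comp (t, x, y) hasFDerivAt_snd)).sub hF).fderiv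
  have hsplit (A : ℝ × E × E →L[ℝ] E →L[ℝ] ℝ) : A (0, z, w) = A (0, z, 0) + A (0, 0, w) := by
    rw [← map_add]; simp
  have hsplit' (A : ℝ × E × E →L[ℝ] ℝ) : A (0, z, w) = A (0, z, 0) + A (0, 0, w) := by
    rw [← map_add]; simp
  rw [hE, h2, h23, h33]
  simp [h3, hsplit (fderiv _ _ _), hsplit' (fderiv _ _ _)]
  ring

/-- The contraction of `Ω_L` with `(1, X, Y)`, with the energy differential expanded. -/
theorem bigOmegaL_one_left {L : ℝ → E → E → ℝ} {t : ℝ} {x y : E}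
    (hL : ContDiffAt ℝ 2 (fun p : ℝ × E × E => L p.1 p.2.1 p.2.2) (t, x, y))
    (X Y : E) (s : ℝ) (z w : E) :
    bigOmegaL L t x y (1, X, Y) (s, z, w) =
      s * (d13L L t x y X + d23L L t x y X y - d2L L t x y X + d33L L t x y Y y)
        + (d2L L t x y z - d13L L t x y z - d23L L t x y X z - d33L L t x y Y z)
        + d23L L t x y z (X - y) + d33L L t x y w (X - y) := by
  have h1 : dEnergyL L t x y (1, X, Y) =
      dEnergyL L t x y (1, 0, 0) + dEnergyL L t x y (0, X, Y) := by
    rw [← map_add]; simp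
  have h2 : dEnergyL L t x y (s, z, w) =
      s * dEnergyL L t x y (1, 0, 0) + dEnergyL L t x y (0, z, w) := by
    rw [← smul_eq_mul, ← map_smul, ← map_add]; simp
  simp only [bigOmegaL, omegaL, h1, h2, dEnergyL_zero_left hL, map_sub]
  ring

/-- Contraction of `Ω_L` with `(1, X, Y)` vanishes exactly when `X = y` and `Y` solves the
Euler–Lagrange equation. -/
theorem bigOmegaL_one_left_eq_zero_iff {L : ℝ → E → E → ℝ} {t : ℝ} {x y : E}
    (hL : ContDiffAt ℝ 2 (fun p : ℝ × E × E => L p.1 p.2.1 p.2.2) (t, x, y))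
    (hsurj : Function.Surjective (d33L L t x y)) (X Y : E) :
    (∀ u, bigOmegaL L t x y (1, X, Y) u = 0) ↔
      X = y ∧ ∀ z, d33L L t x y Y z = d2L L t x y z - d13L L t x y z - d23L L t x y y z := by
  constructor
  · intro h
    have hX : X = y := by
      rw [← sub_eq_zero]
      refine SeparatingDual.eq_zero_of_forall_dual_eq_zero (R := ℝ) fun g => ?_
      obtain ⟨w, rfl⟩ := hsurj g
      simpa [bigOmegaL_one_left hL] using h (0, 0, w)
    subst hX
    refine ⟨rfl, fun z => ?_⟩
    have hz := h (0, z, 0)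
    simp only [bigOmegaL_one_left hL, sub_self, map_zero] at hz
    linarith
  · rintro ⟨rfl, hY⟩ ⟨s, z, w⟩
    rw [bigOmegaL_one_left hL, hY, hY]
    simp only [sub_self, map_zero]
    ring

/-- For a regular time dependent Lagrangian there is exactly one pair of
maps `(X₁, X₂)` with `i_Z dt = 1` and `i_Z Ω_L = 0` for `Z = (1, X₁, X₂)`; moreover
`X₁(t,x,y) = y` (so `Z` is a semispray) and `X₂` is characterized by
`∂₃²L(v)[z, X₂(v)] = ∂₂L(v)z − ∂₁∂₃L(v)[z] − ∂₂∂₃L(v)[z,y]`. -/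
theorem lagrangian_vector_field_exists_unique
    {E : Type*} [NormedAddCommGroup E] [NormedSpace ℝ E] [CompleteSpace E]
    (U : Set E) (hU : IsOpen U) (L : ℝ → E → E → ℝ)
    (hreg : RegularLagrangian L U) :
    ∃ X₁ X₂ : ℝ → E → E → E,
      (∀ t : ℝ, ∀ x ∈ U, ∀ y : E, ∀ u : ℝ × E × E,
        bigOmegaL L t x y (1, X₁ t x y, X₂ t x y) u = 0) ∧
      (∀ X₁' X₂' : ℝ → E → E → E,
        (∀ t : ℝ, ∀ x ∈ U, ∀ y : E, ∀ u : ℝ × E × E,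
          bigOmegaL L t x y (1, X₁' t x y, X₂' t x y) u = 0) →
        ∀ t : ℝ, ∀ x ∈ U, ∀ y : E, X₁' t x y = X₁ t x y ∧ X₂' t x y = X₂ t x y) ∧
      (∀ t : ℝ, ∀ x ∈ U, ∀ y : E, X₁ t x y = y) ∧
      (∀ t : ℝ, ∀ x ∈ U, ∀ y : E,
        (∀ z : E, d33L L t x y (X₂ t x y) z
            = d2L L t x y z - d13L L t x y z - d23L L t x y y z) ∧
        ∀ w : E, (∀ z : E, d33L L t x y w z
            = d2L L t x y z - d13L L t x y z - d23L L t x y y z) → w = X₂ t x y) := by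
  have hL {t : ℝ} {x : E} (hx : x ∈ U) (y : E) :
      ContDiffAt ℝ 2 (fun p : ℝ × E × E => L p.1 p.2.1 p.2.2) (t, x, y) :=
    hreg.1.contDiffAt ((isOpen_univ.prod (hU.prod isOpen_univ)).mem_nhds
      ⟨mem_univ _, hx, mem_univ _⟩)
  have hbij (t : ℝ) {x : E} (hx : x ∈ U) (y : E) : Function.Bijective (d33L L t x y) := by
    obtain ⟨e, he⟩ := hreg.2 t x hx y
    rw [← funext he]
    exact e.bijective
  have hex (t : ℝ) (x y : E) : ∃ Y : E, x ∈ U →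
      d33L L t x y Y = d2L L t x y - d13L L t x y - d23L L t x y y := by
    by_cases hx : x ∈ U
    · obtain ⟨Y, hY⟩ := (hbij t hx y).2 (d2L L t x y - d13L L t x y - d23L L t x y y)
      exact ⟨Y, fun _ => hY⟩
    · exact ⟨0, fun h => absurd h hx⟩
  choose X₂ hX₂ using hex
  have hX₂z (t : ℝ) (x : E) (hx : x ∈ U) (y z : E) : d33L L t x y (X₂ t x y) z
      = d2L L t x y z - d13L L t x y z - d23L L t x y y z := by
    simp [hX₂ t x y hx]
  have huniq (t : ℝ) (x : E) (hx : x ∈ U) (y w : E) (hw : ∀ z : E, d33L L t x y w z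
      = d2L L t x y z - d13L L t x y z - d23L L t x y y z) : w = X₂ t x y :=
    (hbij t hx y).1 <| ContinuousLinearMap.ext fun z => (hw z).trans (hX₂z t x hx y z).symm
  refine ⟨fun _ _ y => y, X₂, fun t x hx y => ?_, fun X₁' X₂' h t x hx y => ?_,
    fun _ _ _ _ => rfl, fun t x hx y => ⟨hX₂z t x hx y, huniq t x hx y⟩⟩
  · exact (bigOmegaL_one_left_eq_zero_iff (hL hx y) (hbij t hx y).2 _ _).2
      ⟨rfl, hX₂z t x hx y⟩
  · obtain ⟨h₁, h₂⟩ :=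
      (bigOmegaL_one_left_eq_zero_iff (hL hx y) (hbij t hx y).2 _ _).1 (h t x hx y)
    exact ⟨h₁, huniq t x hx y _ h₂⟩
end

section
/- Let E be a real Banach space, U ⊆ E open, g : U → L²sym(E;ℝ) a C² map with values in continuous symmetric bilinear forms such that for every x ∈ U the form g(x) induces a continuous linear isomorphism E → E*, and let P : ℝ × U → ℝ be a C² map (a time dependent potential). Define the time dependent Lagrangian L(t,x,y) = (1/2) g(x)(y,y) − P(t,x). Then L is regular, and its canonical semispray coefficient satisfies X₂(t,x,y) = K₂(x,y) − grad P(t,x), where K₂(x,y) ∈ E is the unique element with g(x)(K₂(x,y), z) = (1/2)(Dg(x)z)(y,y) − (Dg(x)y)(y,z) for all z ∈ E (Dg(x) denoting the Fréchet derivative of g at x), and grad P(t,x) ∈ E is the unique element with g(x)(grad P(t,x), z) = ∂₂P(t,x)z for all z ∈ E. -/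
open Set

variable {E : Type*} [NormedAddCommGroup E] [NormedSpace ℝ E]

/-- The fiber derivative of `y ↦ ½ b(y,y) - c` for a symmetric bilinear form `b` is `b`. -/
theorem hasFDerivAt_half_quadratic_sub_const (b : E →L[ℝ] E →L[ℝ] ℝ)
    (hb : ∀ y z : E, b y z = b z y) (c : ℝ) (y : E) :
    HasFDerivAt (fun y' => (1 / 2) * b y' y' - c) (b y) y := by
  have h := ((b.hasFDerivAt (x := y)).clm_apply (hasFDerivAt_id y)).const_mul (1 / 2 : ℝ)
  refine (h.sub_const c).congr_fderiv ?_
  ext z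
  simp [hb z y]
  ring

section PotentialField

variable {U : Set E} {g : E → E →L[ℝ] E →L[ℝ] ℝ} {P : ℝ → E → ℝ} {L : ℝ → E → E → ℝ}

theorem d3L_of_potential_field
    (hL : ∀ (t : ℝ) (x y : E), L t x y = (1 / 2) * g x y y - P t x) {x : E}
    (hgsym : ∀ y z : E, g x y z = g x z y) (t : ℝ) (y : E) :
    d3L L t x y = g x y := by
  simp only [d3L, hL]
  exact (hasFDerivAt_half_quadratic_sub_const (g x) hgsym (P t x) y).fderiv

theorem d13L_of_potential_field
    (hL : ∀ (t : ℝ) (x y : E), L t x y = (1 / 2) * g x y y - P t x) {x : E}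
    (hgsym : ∀ y z : E, g x y z = g x z y) (t : ℝ) (y : E) :
    d13L L t x y = 0 := by
  simp only [d13L, d3L_of_potential_field hL hgsym, deriv_const]

theorem d33L_of_potential_field
    (hL : ∀ (t : ℝ) (x y : E), L t x y = (1 / 2) * g x y y - P t x) {x : E}
    (hgsym : ∀ y z : E, g x y z = g x z y) (t : ℝ) (y : E) :
    d33L L t x y = g x := by
  simp only [d33L, d3L_of_potential_field hL hgsym]
  exact (g x).fderiv

theorem d23L_of_potential_field (hU : IsOpen U)
    (hgsym : ∀ x ∈ U, ∀ y z : E, g x y z = g x z y)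
    (hL : ∀ (t : ℝ) (x y : E), L t x y = (1 / 2) * g x y y - P t x)
    {x : E} (hx : x ∈ U) (hg : DifferentiableAt ℝ g x) (t : ℝ) (y a : E) :
    d23L L t x y a = fderiv ℝ g x a y := by
  have heq : (fun x' => d3L L t x' y) =ᶠ[nhds x] fun x' => g x' y := by
    filter_upwards [hU.mem_nhds hx] with x' hx'
    exact d3L_of_potential_field hL (hgsym x' hx') t y
  rw [d23L, heq.fderiv_eq, (hg.hasFDerivAt.clm_apply (hasFDerivAt_const y x)).fderiv]
  simp

theorem d2L_of_potential_field
    (hL : ∀ (t : ℝ) (x y : E), L t x y = (1 / 2) * g x y y - P t x)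
    {x : E} (hg : DifferentiableAt ℝ g x) {t : ℝ} (hP : DifferentiableAt ℝ (P t) x) (y z : E) :
    d2L L t x y z = (1 / 2) * fderiv ℝ g x z y y - fderiv ℝ (P t) x z := by
  have h := (((hg.hasFDerivAt.clm_apply (hasFDerivAt_const y x)).clm_apply
    (hasFDerivAt_const y x)).const_mul (1 / 2 : ℝ)).sub hP.hasFDerivAt
  have hfun : (fun x' => L t x' y) = fun x' => (1 / 2) * g x' y y - P t x' :=
    funext fun x' => hL t x' y
  rw [d2L, hfun]
  refine (congrArg (fun A : E →L[ℝ] ℝ => A z) h.fderiv).trans ?_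
  simp

theorem contDiffOn_of_potential_field (hg : ContDiffOn ℝ 2 g U)
    (hP : ContDiffOn ℝ 2 (fun p : ℝ × E => P p.1 p.2) (univ ×ˢ U))
    (hL : ∀ (t : ℝ) (x y : E), L t x y = (1 / 2) * g x y y - P t x) :
    ContDiffOn ℝ 2 (fun p : ℝ × E × E => L p.1 p.2.1 p.2.2) (univ ×ˢ U ×ˢ univ) := by
  simp only [hL]
  have hy : ContDiffOn ℝ 2 (fun p : ℝ × E × E => p.2.2) (univ ×ˢ U ×ˢ univ) :=
    contDiff_snd.snd.contDiffOn
  have hgx : ContDiffOn ℝ 2 (fun p : ℝ × E × E => g p.2.1) (univ ×ˢ U ×ˢ univ) :=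
    hg.comp contDiff_snd.fst.contDiffOn fun p hp => hp.2.1
  have hPx : ContDiffOn ℝ 2 (fun p : ℝ × E × E => P p.1 p.2.1) (univ ×ˢ U ×ˢ univ) :=
    hP.comp (contDiff_fst.prodMk contDiff_snd.fst).contDiffOn fun p hp => ⟨trivial, hp.2.1⟩
  exact (contDiffOn_const.mul ((hgx.clm_apply hy).clm_apply hy)).sub hPx

end PotentialField

/-- For the Lagrangian `L(t,x,y) = ½ g(x)(y,y) − P(t,x)` of a motion in
a time dependent potential field, `L` is regular and its canonical semispray coefficient
is `X₂ = K₂ − grad P`, where `K₂` is the canonical spray of the metric `g` and `grad P`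
the `g`-gradient of the potential. -/
theorem semispray_of_potential_field
    {E : Type*} [NormedAddCommGroup E] [NormedSpace ℝ E] [CompleteSpace E]
    (U : Set E) (hU : IsOpen U)
    (g : E → E →L[ℝ] E →L[ℝ] ℝ) (hg : ContDiffOn ℝ 2 g U)
    (hgsym : ∀ x ∈ U, ∀ y z : E, g x y z = g x z y)
    (hgreg : ∀ x ∈ U, ∃ e : E ≃L[ℝ] (E →L[ℝ] ℝ), ∀ X : E, e X = g x X)
    (P : ℝ → E → ℝ)
    (hP : ContDiffOn ℝ 2 (fun p : ℝ × E => P p.1 p.2) (univ ×ˢ U))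
    (L : ℝ → E → E → ℝ)
    (hL : ∀ (t : ℝ) (x y : E), L t x y = (1 / 2) * g x y y - P t x) :
    RegularLagrangian L U ∧
    ∀ t : ℝ, ∀ x ∈ U, ∀ y : E, ∀ X₂ K₂ gradP : E,
      -- X₂ is the canonical semispray coefficient of L at (t,x,y)
      (∀ z : E, d33L L t x y X₂ z
          = d2L L t x y z - d13L L t x y z - d23L L t x y y z) →
      -- K₂ is the canonical spray of g at (x,y):
      -- g(x)(K₂,z) = ½ (Dg(x)z)(y,y) − (Dg(x)y)(y,z)
      (∀ z : E, g x K₂ z = (1 / 2) * (fderiv ℝ g x z y y) - fderiv ℝ g x y y z) →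
      -- gradP is the g-gradient of P at (t,x): g(x)(gradP, z) = ∂₂P(t,x)z
      (∀ z : E, g x gradP z = fderiv ℝ (fun x' => P t x') x z) →
      X₂ = K₂ - gradP := by
  refine ⟨⟨contDiffOn_of_potential_field hg hP hL, fun t x hx y => ?_⟩, ?_⟩
  · rw [d33L_of_potential_field hL (hgsym x hx)]
    exact hgreg x hx
  intro t x hx y X₂ K₂ gradP hX hK hgrad
  have hgx : DifferentiableAt ℝ g x :=
    (hg.contDiffAt (hU.mem_nhds hx)).differentiableAt (by norm_num)
  have hPx : DifferentiableAt ℝ (P t) x := by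
    have hjoint : DifferentiableAt ℝ (fun p : ℝ × E => P p.1 p.2) (t, x) :=
      (hP.contDiffAt ((isOpen_univ.prod hU).mem_nhds ⟨trivial, hx⟩)).differentiableAt
        (by norm_num)
    exact hjoint.comp x ((differentiableAt_const t).prodMk differentiableAt_id)
  obtain ⟨e, he⟩ := hgreg x hx
  apply e.injective
  ext z
  have hXz := hX z
  rw [d33L_of_potential_field hL (hgsym x hx), d13L_of_potential_field hL (hgsym x hx),
    d23L_of_potential_field hU hgsym hL hx hgx, d2L_of_potential_field hL hgx hPx] at hXz
  rw [he, he, map_sub, sub_apply, hXz, hK, hgrad,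
    zero_apply]
  ring
end

section
/- Let E be a real Banach space, U, V ⊆ E open, φ : U → V a C³ diffeomorphism, L' : ℝ × V × E → ℝ a regular time dependent Lagrangian of class C², and define L(t,x,y) := L'(t, φ(x), dφ(x)y). Then L is a regular time dependent Lagrangian, and the maps G : ℝ × U × E → E and G' : ℝ × V × E → E defined (uniquely, by regularity) by the conditions ∂₃²L(v)[G(v), z] = ∂₂∂₃L(v)[z, y] − ∂₂L(v)z for all z ∈ E (at v = (t,x,y)), and analogously for G' and L', satisfy the semispray compatibility condition dφ(x)[G(t,x,y)] = G'(t, φ(x), dφ(x)y) + d²φ(x)(y,y) for all (t,x,y) ∈ ℝ × U × E. -/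
open Set

variable {E : Type*} [NormedAddCommGroup E] [NormedSpace ℝ E]

section

variable {L : ℝ → E → E → ℝ} {t : ℝ} {x y : E}

theorem hasFDerivAt_slice_of_contDiffAt
    (h : ContDiffAt ℝ 2 (fun q : E × E => L t q.1 q.2) (x, y)) :
    HasFDerivAt (fun q : E × E => L t q.1 q.2) ((d2L L t x y).coprod (d3L L t x y)) (x, y) := by
  have hd := (h.differentiableAt (by norm_num)).hasFDerivAt
  have h2 : d2L L t x y = (fderiv ℝ (fun q : E × E => L t q.1 q.2) (x, y)) ∘L .inl ℝ E E :=
    (hd.comp (f := fun x' => (x', y)) x (hasFDerivAt_prodMk_left x y)).fderiv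
  have h3 : d3L L t x y = (fderiv ℝ (fun q : E × E => L t q.1 q.2) (x, y)) ∘L .inr ℝ E E :=
    (hd.comp (f := fun y' => (x, y')) y (hasFDerivAt_prodMk_right x y)).fderiv
  rwa [h2, h3, ContinuousLinearMap.coprod_comp_inl_inr]

theorem hasFDerivAt_d3L_of_contDiffAt
    (h : ContDiffAt ℝ 2 (fun q : E × E => L t q.1 q.2) (x, y)) :
    HasFDerivAt (fun q : E × E => d3L L t q.1 q.2)
      ((d23L L t x y).coprod (d33L L t x y)) (x, y) := by
  have heq : (fun q : E × E => d3L L t q.1 q.2) =ᶠ[nhds (x, y)]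
      fun q => (fderiv ℝ (fun q : E × E => L t q.1 q.2) q) ∘L .inr ℝ E E := by
    filter_upwards [h.eventually (by norm_num)] with q hq
    rw [(hasFDerivAt_slice_of_contDiffAt (x := q.1) (y := q.2) hq).fderiv,
      ContinuousLinearMap.coprod_comp_inr]
  have hd : DifferentiableAt ℝ (fun q : E × E => d3L L t q.1 q.2) (x, y) := by
    refine DifferentiableAt.congr_of_eventuallyEq ?_ heq
    exact ((h.fderiv_right (m := 1) (by norm_num)).differentiableAt (by norm_num)).clm_comp
      (differentiableAt_const _)
  have hd := hd.hasFDerivAt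
  have h2 : d23L L t x y = (fderiv ℝ (fun q : E × E => d3L L t q.1 q.2) (x, y)) ∘L .inl ℝ E E :=
    (hd.comp (f := fun x' => (x', y)) x (hasFDerivAt_prodMk_left x y)).fderiv
  have h3 : d33L L t x y = (fderiv ℝ (fun q : E × E => d3L L t q.1 q.2) (x, y)) ∘L .inr ℝ E E :=
    (hd.comp (f := fun y' => (x, y')) y (hasFDerivAt_prodMk_right x y)).fderiv
  rwa [h2, h3, ContinuousLinearMap.coprod_comp_inl_inr]

theorem d33L_symm_of_contDiffAt
    (h : ContDiffAt ℝ 2 (fun q : E × E => L t q.1 q.2) (x, y)) (v w : E) :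
    d33L L t x y v w = d33L L t x y w v := by
  have h' : ContDiffAt ℝ 2 (fun y' => L t x y') y :=
    ContDiffAt.comp (g := fun q : E × E => L t q.1 q.2) y h
      (contDiffAt_const.prodMk contDiffAt_id)
  exact (h'.isSymmSndFDerivAt (by simp)).eq v w

theorem contDiffAt_slice_of_contDiffOn {U : Set E} (hU : IsOpen U)
    (h : ContDiffOn ℝ 2 (fun p : ℝ × E × E => L p.1 p.2.1 p.2.2) (univ ×ˢ U ×ˢ univ))
    (hx : x ∈ U) : ContDiffAt ℝ 2 (fun q : E × E => L t q.1 q.2) (x, y) :=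
  ContDiffAt.comp (g := fun p : ℝ × E × E => L p.1 p.2.1 p.2.2) (x, y)
    (h.contDiffAt ((isOpen_univ.prod (hU.prod isOpen_univ)).mem_nhds ⟨trivial, hx, trivial⟩))
    (contDiffAt_const.prodMk contDiffAt_id)

end

section Pullback

variable {L L' : ℝ → E → E → ℝ} {φ : E → E} {dφ : E → E →L[ℝ] E} {d2φ : E →L[ℝ] E →L[ℝ] E}
  {t : ℝ} {x y : E}

theorem d3L_pullback (hL : ∀ (t : ℝ) (x y : E), L t x y = L' t (φ x) (dφ x y))
    (h : ContDiffAt ℝ 2 (fun q : E × E => L' t q.1 q.2) (φ x, dφ x y)) :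
    d3L L t x y = d3L L' t (φ x) (dφ x y) ∘L dφ x := by
  have hd := (hasFDerivAt_slice_of_contDiffAt h).comp y
    ((hasFDerivAt_const (φ x) y).prodMk (dφ x).hasFDerivAt)
  simp only [d3L, hL]
  refine hd.fderiv.trans ?_
  ext z
  simp [d3L]

theorem d2L_pullback (hL : ∀ (t : ℝ) (x y : E), L t x y = L' t (φ x) (dφ x y))
    (hφ : HasFDerivAt φ (dφ x) x) (hdφ : HasFDerivAt dφ d2φ x)
    (h : ContDiffAt ℝ 2 (fun q : E × E => L' t q.1 q.2) (φ x, dφ x y)) (z : E) :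
    d2L L t x y z
      = d2L L' t (φ x) (dφ x y) (dφ x z) + d3L L' t (φ x) (dφ x y) (d2φ z y) := by
  have hd := (hasFDerivAt_slice_of_contDiffAt h).comp x
    (hφ.prodMk (hdφ.clm_apply (hasFDerivAt_const y x)))
  have he : d2L L t x y = _ :=
    (hd.congr_of_eventuallyEq (f₁ := fun x' => L t x' y)
      (.of_forall fun x' => hL t x' y)).fderiv
  rw [he]
  simp

theorem d33L_pullback (hL : ∀ (t : ℝ) (x y : E), L t x y = L' t (φ x) (dφ x y))
    (h : ∀ y, ContDiffAt ℝ 2 (fun q : E × E => L' t q.1 q.2) (φ x, dφ x y)) (w z : E) :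
    d33L L t x y w z = d33L L' t (φ x) (dφ x y) (dφ x w) (dφ x z) := by
  have hd := ((hasFDerivAt_d3L_of_contDiffAt (h y)).comp y
    ((hasFDerivAt_const (φ x) y).prodMk (dφ x).hasFDerivAt)).clm_comp
      (hasFDerivAt_const (dφ x) y)
  have he : d33L L t x y = _ :=
    (hd.congr_of_eventuallyEq (f₁ := fun y' => d3L L t x y')
      (.of_forall fun y' => d3L_pullback hL (h y'))).fderiv
  rw [he]
  simp

theorem d23L_pullback (hL : ∀ (t : ℝ) (x y : E), L t x y = L' t (φ x) (dφ x y))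
    (hφ : HasFDerivAt φ (dφ x) x) (hdφ : HasFDerivAt dφ d2φ x)
    (h : ∀ᶠ x' in nhds x, ContDiffAt ℝ 2 (fun q : E × E => L' t q.1 q.2) (φ x', dφ x' y))
    (a z : E) :
    d23L L t x y a z = d23L L' t (φ x) (dφ x y) (dφ x a) (dφ x z)
      + d33L L' t (φ x) (dφ x y) (d2φ a y) (dφ x z)
      + d3L L' t (φ x) (dφ x y) (d2φ a z) := by
  have hd := ((hasFDerivAt_d3L_of_contDiffAt h.self_of_nhds).comp x
    (hφ.prodMk (hdφ.clm_apply (hasFDerivAt_const y x)))).clm_comp hdφ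
  have he : d23L L t x y = _ :=
    (hd.congr_of_eventuallyEq (f₁ := fun x' => d3L L t x' y)
      (h.mono fun x' hx' => d3L_pullback hL hx')).fderiv
  rw [he]
  simp
  ring

theorem contDiffOn_pullback {U V : Set E} (hU : IsOpen U) (hφ : ContDiffOn ℝ 3 φ U)
    (hφUV : MapsTo φ U V) (hdφ : ∀ x ∈ U, HasFDerivAt φ (dφ x) x)
    (hL' : ContDiffOn ℝ 2 (fun p : ℝ × E × E => L' p.1 p.2.1 p.2.2) (univ ×ˢ V ×ˢ univ))
    (hL : ∀ (t : ℝ) (x y : E), L t x y = L' t (φ x) (dφ x y)) :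
    ContDiffOn ℝ 2 (fun p : ℝ × E × E => L p.1 p.2.1 p.2.2) (univ ×ˢ U ×ˢ univ) := by
  have hφ' : ContDiffOn ℝ 2 dφ U :=
    (hφ.fderiv_of_isOpen hU (by norm_num)).congr fun x hx => (hdφ x hx).fderiv.symm
  have hfst : ContDiffOn ℝ 2 (fun p : ℝ × E × E => p.2.1) (univ ×ˢ U ×ˢ univ) :=
    (contDiff_fst.comp contDiff_snd).contDiffOn
  have hsnd : ContDiffOn ℝ 2 (fun p : ℝ × E × E => p.2.2) (univ ×ˢ U ×ˢ univ) :=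
    (contDiff_snd.comp contDiff_snd).contDiffOn
  have hmaps : MapsTo (fun p : ℝ × E × E => p.2.1) (univ ×ˢ U ×ˢ univ) U := fun p hp => hp.2.1
  simp only [hL]
  exact hL'.comp (contDiff_fst.contDiffOn.prodMk
    (((hφ.of_le (by norm_num)).comp hfst hmaps).prodMk ((hφ'.comp hfst hmaps).clm_apply hsnd)))
    fun p hp => ⟨trivial, hφUV hp.2.1, trivial⟩

end Pullback

/-- If `L' ` is a regular time dependent Lagrangian on the chart `V` and
`L(t,x,y) = L'(t, φ(x), dφ(x)y)` is its pullback through the C³ transition `φ`, then `L`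
is regular and the semispray coefficients `G` of `L` and `G'` of `L'` (defined by
`∂₃²L(v)[G(v),z] = ∂₂∂₃L(v)[z,y] − ∂₂L(v)z`) satisfy the semispray compatibility
condition `dφ(x)G(t,x,y) = G'(t,φ(x),dφ(x)y) + d²φ(x)(y,y)`. -/
theorem pullback_lagrangian_semispray_compatibility
    {E : Type*} [NormedAddCommGroup E] [NormedSpace ℝ E] [CompleteSpace E]
    (U V : Set E) (hU : IsOpen U) (hV : IsOpen V)
    (φ ψ : E → E) (hφ : ContDiffOn ℝ 3 φ U) (hψ : ContDiffOn ℝ 3 ψ V)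
    (hφUV : MapsTo φ U V) (hψVU : MapsTo ψ V U)
    (hleft : ∀ x ∈ U, ψ (φ x) = x) (hright : ∀ y ∈ V, φ (ψ y) = y)
    (dφ : E → E →L[ℝ] E) (hdφ : ∀ x ∈ U, HasFDerivAt φ (dφ x) x)
    (d2φ : E → E →L[ℝ] E →L[ℝ] E) (hd2φ : ∀ x ∈ U, HasFDerivAt dφ (d2φ x) x)
    (L' : ℝ → E → E → ℝ) (hreg' : RegularLagrangian L' V)
    (L : ℝ → E → E → ℝ)
    (hL : ∀ (t : ℝ) (x y : E), L t x y = L' t (φ x) (dφ x y)) :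
    RegularLagrangian L U ∧
    ∀ t : ℝ, ∀ x ∈ U, ∀ y : E, ∀ G G' : E,
      (∀ z : E, d33L L t x y z G = d23L L t x y y z - d2L L t x y z) →
      (∀ z : E, d33L L' t (φ x) (dφ x y) z G'
          = d23L L' t (φ x) (dφ x y) (dφ x y) z - d2L L' t (φ x) (dφ x y) z) →
      dφ x G = G' + d2φ x y y := by
  have hsm : ∀ t : ℝ, ∀ x ∈ U, ∀ y : E,
      ContDiffAt ℝ 2 (fun q : E × E => L' t q.1 q.2) (φ x, dφ x y) := fun t x hx y =>
    contDiffAt_slice_of_contDiffOn hV hreg'.1 (hφUV hx)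
  have hequiv : ∀ x ∈ U, ∃ A : E ≃L[ℝ] E, (A : E →L[ℝ] E) = dφ x := by
    intro x hx
    have hψx : HasFDerivAt ψ (fderiv ℝ ψ (φ x)) (φ x) :=
      ((hψ.contDiffAt (hV.mem_nhds (hφUV hx))).differentiableAt (by norm_num)).hasFDerivAt
    have hφx : HasFDerivAt φ (dφ x) (ψ (φ x)) := by
      rw [hleft x hx]
      exact hdφ x hx
    have h₁ : fderiv ℝ ψ (φ x) ∘L dφ x = .id ℝ E :=
      (hψx.comp x (hdφ x hx)).unique ((hasFDerivAt_id x).congr_of_eventuallyEq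
        (Filter.eventually_of_mem (hU.mem_nhds hx) hleft))
    have h₂ : dφ x ∘L fderiv ℝ ψ (φ x) = .id ℝ E :=
      (hφx.comp (φ x) hψx).unique ((hasFDerivAt_id (φ x)).congr_of_eventuallyEq
        (Filter.eventually_of_mem (hV.mem_nhds (hφUV hx)) hright))
    exact ⟨.equivOfInverse (dφ x) (fderiv ℝ ψ (φ x)) (DFunLike.congr_fun h₁)
      (DFunLike.congr_fun h₂), rfl⟩
  refine ⟨⟨contDiffOn_pullback hU hφ hφUV hdφ hreg'.1 hL, fun t x hx y => ?_⟩, ?_⟩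
  · obtain ⟨A, hA⟩ := hequiv x hx
    obtain ⟨e, he⟩ := hreg'.2 t (φ x) (hφUV hx) (dφ x y)
    refine ⟨(A.trans e).trans (A.symm.arrowCongr (.refl ℝ ℝ)), fun X => ?_⟩
    ext z
    rw [d33L_pullback hL (hsm t x hx), ← he, ← hA]
    simp
  · intro t x hx y G G' hG hG'
    obtain ⟨A, hA⟩ := hequiv x hx
    obtain ⟨e, he⟩ := hreg'.2 t (φ x) (hφUV hx) (dφ x y)
    have hUx := hU.mem_nhds hx
    have hsymm := second_derivative_symmetric_of_eventually
      (Filter.eventually_of_mem hUx hdφ) (hd2φ x hx)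
    have hsymm' := d33L_symm_of_contDiffAt (hsm t x hx y)
    apply e.injective
    ext w
    obtain ⟨z, rfl⟩ : ∃ z, dφ x z = w := ⟨A.symm w, by simp [← hA]⟩
    have h := hG z
    rw [d33L_pullback hL (hsm t x hx), d2L_pullback hL (hdφ x hx) (hd2φ x hx) (hsm t x hx y),
      d23L_pullback hL (hdφ x hx) (hd2φ x hx)
        (Filter.eventually_of_mem hUx fun x' hx' => hsm t x' hx' y), hsymm y z] at h
    rw [he, he, map_add, add_apply, hsymm' (dφ x G), hsymm' G']
    linarith [hG' (dφ x z)]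
end

section
/- Let E be a real Banach space, U, V ⊆ E open, φ : U → V a C³ diffeomorphism, L' : ℝ × V × E → ℝ a regular time dependent Lagrangian of class C², and define L(t,x,y) := L'(t, φ(x), dφ(x)y). Define N⁰ : ℝ × U × E → E (uniquely, by regularity) by ∂₃²L(v)[z, N⁰(v)] = ∂₁∂₃L(v)[z] for all z ∈ E, at v = (t,x,y), and analogously N'⁰ for L'. Then dφ(x)[N⁰(t,x,y)] = N'⁰(t, φ(x), dφ(x)y) for all (t,x,y) ∈ ℝ × U × E; that is, the time-component connection coefficient N⁰ = (∂₃²L)⁻¹∂₁∂₃L determined by the Lagrangian transforms tensorially under the change of chart. -/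
open Set

variable {E : Type*} [NormedAddCommGroup E] [NormedSpace ℝ E]

/-- Precomposing the fiber variable with a continuous linear equivalence `A` precomposes `∂₃L`
with `A`. -/
lemma d3L_of_comp_equiv {L L' : ℝ → E → E → ℝ} {x x' : E} (A : E ≃L[ℝ] E)
    (hL : ∀ t y, L t x y = L' t x' (A y)) (t : ℝ) (y : E) :
    d3L L t x y = (d3L L' t x' (A y)).comp (A : E →L[ℝ] E) := by
  have h : (fun y' => L t x y') = (fun y' => L' t x' y') ∘ A := funext fun y' => hL t y'
  rw [d3L, d3L, h, A.comp_right_fderiv]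

lemma d13L_of_comp_equiv {L L' : ℝ → E → E → ℝ} {x x' : E} (A : E ≃L[ℝ] E)
    (hL : ∀ t y, L t x y = L' t x' (A y)) (t : ℝ) (y z : E) :
    d13L L t x y z = d13L L' t x' (A y) (A z) := by
  have h : (fun t' => d3L L t' x y) =
      A.symm.arrowCongr (ContinuousLinearEquiv.refl ℝ ℝ) ∘ fun t' => d3L L' t' x' (A y) := by
    ext t' w
    simp [d3L_of_comp_equiv A hL]
  rw [d13L, d13L, h, ← fderiv_apply_one_eq_deriv, ← fderiv_apply_one_eq_deriv,
    ContinuousLinearEquiv.comp_fderiv]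
  simp

lemma d33L_of_comp_equiv {L L' : ℝ → E → E → ℝ} {x x' : E} (A : E ≃L[ℝ] E)
    (hL : ∀ t y, L t x y = L' t x' (A y)) (t : ℝ) (y w z : E) :
    d33L L t x y w z = d33L L' t x' (A y) (A w) (A z) := by
  have h : (fun y' => d3L L t x y') =
      A.symm.arrowCongr (ContinuousLinearEquiv.refl ℝ ℝ) ∘ (fun y' => d3L L' t x' y') ∘ A := by
    ext y' w
    simp [d3L_of_comp_equiv A hL]
  rw [d33L, d33L, h, ContinuousLinearEquiv.comp_fderiv, A.comp_right_fderiv]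
  simp

/-- The derivatives of mutually inverse differentiable maps are mutually inverse. -/
lemma HasFDerivAt.comp_eq_id_of_leftInvOn {f g : E → E} {f' g' : E →L[ℝ] E} {x : E} {U : Set E}
    (hU : U ∈ nhds x) (hg : HasFDerivAt g g' (f x)) (hf : HasFDerivAt f f' x)
    (h : ∀ y ∈ U, g (f y) = y) : g'.comp f' = ContinuousLinearMap.id ℝ E :=
  (hg.comp x hf).unique <| (hasFDerivAt_id x).congr_of_eventuallyEq <|
    Filter.mem_of_superset hU h

/-- For the pullback `L(t,x,y) = L'(t,φ(x),dφ(x)y)` of a regular time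
dependent Lagrangian through a C³ transition, the time-component connection coefficient
`N⁰ = (∂₃²L)⁻¹ ∂₁∂₃L` transforms tensorially:
`dφ(x)[N⁰(t,x,y)] = N'⁰(t, φ(x), dφ(x)y)`. -/
theorem time_connection_coefficient_tensorial
    {E : Type*} [NormedAddCommGroup E] [NormedSpace ℝ E] [CompleteSpace E]
    (U V : Set E) (hU : IsOpen U) (hV : IsOpen V)
    (φ ψ : E → E) (hφ : ContDiffOn ℝ 3 φ U) (hψ : ContDiffOn ℝ 3 ψ V)
    (hφUV : MapsTo φ U V) (hψVU : MapsTo ψ V U)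
    (hleft : ∀ x ∈ U, ψ (φ x) = x) (hright : ∀ y ∈ V, φ (ψ y) = y)
    (dφ : E → E →L[ℝ] E) (hdφ : ∀ x ∈ U, HasFDerivAt φ (dφ x) x)
    (d2φ : E → E →L[ℝ] E →L[ℝ] E) (hd2φ : ∀ x ∈ U, HasFDerivAt dφ (d2φ x) x)
    (L' : ℝ → E → E → ℝ) (hreg' : RegularLagrangian L' V)
    (L : ℝ → E → E → ℝ)
    (hL : ∀ (t : ℝ) (x y : E), L t x y = L' t (φ x) (dφ x y)) :
    ∀ t : ℝ, ∀ x ∈ U, ∀ y : E, ∀ N0 N0' : E,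
      -- ∂₃²L(v)[z, N⁰(v)] = ∂₁∂₃L(v)[z] for all z
      (∀ z : E, d33L L t x y N0 z = d13L L t x y z) →
      (∀ z : E, d33L L' t (φ x) (dφ x y) N0' z = d13L L' t (φ x) (dφ x y) z) →
      dφ x N0 = N0' := by
  intro t x hx y N0 N0' hN hN'
  have hVx : V ∈ nhds (φ x) := hV.mem_nhds (hφUV hx)
  have hdψ : HasFDerivAt ψ (fderiv ℝ ψ (φ x)) (φ x) :=
    ((hψ.contDiffAt hVx).differentiableAt (by norm_num)).hasFDerivAt
  have hψφ := hdψ.comp_eq_id_of_leftInvOn (hU.mem_nhds hx) (hdφ x hx) hleft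
  have hφψ : (dφ x).comp (fderiv ℝ ψ (φ x)) = ContinuousLinearMap.id ℝ E :=
    HasFDerivAt.comp_eq_id_of_leftInvOn hVx (by rw [hleft x hx]; exact hdφ x hx) hdψ hright
  let A : E ≃L[ℝ] E := ContinuousLinearEquiv.equivOfInverse (dφ x) (fderiv ℝ ψ (φ x))
    (DFunLike.congr_fun hψφ) (DFunLike.congr_fun hφψ)
  have hA : ∀ t y, L t x y = L' t (φ x) (A y) := fun t y => hL t x y
  obtain ⟨e, he⟩ := hreg'.2 t (φ x) (hφUV hx) (dφ x y)
  apply e.injective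
  rw [he, he]
  ext z
  obtain ⟨w, rfl⟩ := A.surjective z
  calc d33L L' t (φ x) (dφ x y) (dφ x N0) (A w)
      = d33L L t x y N0 w := (d33L_of_comp_equiv A hA t y N0 w).symm
    _ = d13L L t x y w := hN w
    _ = d13L L' t (φ x) (dφ x y) (A w) := d13L_of_comp_equiv A hA t y w
    _ = d33L L' t (φ x) (dφ x y) N0' (A w) := (hN' (A w)).symm
end

section
/- Let L : ℝ × U × E → ℝ be a regular time dependent Lagrangian of class C². For a vertical vector field Y(v) = (0, 0, Y₂(v)) on ℝ × U × E, the 1-form −i_Yω_L is given by (−i_Yω_L)(v)(s,z,w) = ∂₃²L(v)[z, Y₂(v)], hence it is semi-basic (it vanishes on all vectors of the form (0,0,w) and (s,0,0)). Moreover, the assignment Y₂ ↦ −i_Yω_L is a bijection from maps Y₂ : ℝ × U × E → E onto semi-basic 1-forms: for every map α : ℝ × U × E → E* there is a unique Y₂ : ℝ × U × E → E with (−i_Yω_L)(v)(s,z,w) = α(v)z for all v and (s,z,w), namely Y₂(v) = (∂₃²L(v)♭)⁻¹(α(v)), where ∂₃²L(v)♭ : E → E* is the isomorphism X ↦ ∂₃²L(v)[·,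 X]. -/
open Set

variable {E : Type*} [NormedAddCommGroup E] [NormedSpace ℝ E]

/-- Contracting `-ω_L` with a vertical vector `(0, 0, a)` gives `∂₃²L[·, a]`. -/
theorem neg_omegaL_vertical {E : Type*} [NormedAddCommGroup E] [NormedSpace ℝ E]
    (L : ℝ → E → E → ℝ) (t : ℝ) (x y a : E) (s : ℝ) (z w : E) :
    -(omegaL L t x y ((0 : ℝ), (0 : E), a) (s, z, w)) = d33L L t x y a z := by
  simp [omegaL]

/-- For a regular time dependent Lagrangian, contraction of `ω_L` with
a vertical vector field `Y = (0,0,Y₂)` gives the semi-basic 1-form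
`(−i_Yω_L)(v)(s,z,w) = ∂₃²L(v)[z, Y₂(v)]`, and `Y₂ ↦ −i_Yω_L` is a bijection onto
semi-basic 1-forms, with inverse `α ↦ (∂₃²L♭)⁻¹ ∘ α`. -/
theorem vertical_fields_correspond_to_semibasic_forms
    {E : Type*} [NormedAddCommGroup E] [NormedSpace ℝ E] [CompleteSpace E]
    (U : Set E) (hU : IsOpen U) (L : ℝ → E → E → ℝ)
    (hreg : RegularLagrangian L U) :
    -- the contraction formula
    (∀ Y₂ : ℝ → E → E → E, ∀ t : ℝ, ∀ x ∈ U, ∀ y : E, ∀ (s : ℝ) (z w : E),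
      -(omegaL L t x y ((0 : ℝ), (0 : E), Y₂ t x y) (s, z, w))
        = d33L L t x y (Y₂ t x y) z) ∧
    -- semi-basic: it vanishes on vectors (0,0,w) and (s,0,0)
    (∀ Y₂ : ℝ → E → E → E, ∀ t : ℝ, ∀ x ∈ U, ∀ y : E,
      (∀ w : E, -(omegaL L t x y ((0 : ℝ), (0 : E), Y₂ t x y) ((0 : ℝ), (0 : E), w)) = 0) ∧
      (∀ s : ℝ, -(omegaL L t x y ((0 : ℝ), (0 : E), Y₂ t x y) (s, (0 : E), (0 : E))) = 0)) ∧
    -- bijectivity onto semi-basic forms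
    (∀ α : ℝ → E → E → (E →L[ℝ] ℝ),
      ∃ Y₂ : ℝ → E → E → E,
        (∀ t : ℝ, ∀ x ∈ U, ∀ y : E, ∀ (s : ℝ) (z w : E),
          -(omegaL L t x y ((0 : ℝ), (0 : E), Y₂ t x y) (s, z, w)) = α t x y z) ∧
        -- namely Y₂(v) = (∂₃²L(v)♭)⁻¹(α(v)), i.e. ∂₃²L(v)[·, Y₂(v)] = α(v)
        (∀ t : ℝ, ∀ x ∈ U, ∀ y : E, d33L L t x y (Y₂ t x y) = α t x y) ∧
        (∀ Y₂' : ℝ → E → E → E,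
          (∀ t : ℝ, ∀ x ∈ U, ∀ y : E, ∀ (s : ℝ) (z w : E),
            -(omegaL L t x y ((0 : ℝ), (0 : E), Y₂' t x y) (s, z, w)) = α t x y z) →
          ∀ t : ℝ, ∀ x ∈ U, ∀ y : E, Y₂' t x y = Y₂ t x y)) := by
  have contraction := neg_omegaL_vertical L
  refine ⟨fun Y₂ t x _ y s z w => contraction t x y (Y₂ t x y) s z w, fun Y₂ t x _ y => ⟨?_, ?_⟩, ?_⟩
  · intro w
    rw [contraction, map_zero]
  · intro s
    rw [contraction, map_zero]
  · intro α
    have bijective : ∀ t : ℝ, ∀ x ∈ U, ∀ y : E, Function.Bijective (d33L L t x y) := by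
      intro t x hx y
      obtain ⟨e, he⟩ := hreg.2 t x hx y
      rw [← funext he]
      exact e.bijective
    have surj : ∀ t x y, ∃ X : E, x ∈ U → d33L L t x y X = α t x y := by
      intro t x y
      by_cases hx : x ∈ U
      · obtain ⟨X, hX⟩ := (bijective t x hx y).surjective (α t x y)
        exact ⟨X, fun _ => hX⟩
      · exact ⟨0, fun h => absurd h hx⟩
    choose Y₂ hY₂ using surj
    refine ⟨Y₂, fun t x hx y s z w => ?_, fun t x hx y => hY₂ t x y hx,
      fun Y₂' hY₂' t x hx y => (bijective t x hx y).injective ?_⟩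
    · rw [contraction, hY₂ t x y hx]
    · rw [hY₂ t x y hx]
      ext z
      rw [← contraction t x y (Y₂' t x y) 0 z 0, hY₂' t x hx y]
end
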